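/- Deterministic upper bound: if 𝒞 is nonempty, then for every μ ∈ ℝ^d, ℓ ≤ exp(sup_{x ∈ 𝒞} ψ(x;μ)). In particular ℓ ≤ exp(ψ(x*;μ*)) for any saddle point (x*, μ*) attaining inf_μ sup_{x∈𝒞} ψ(x;μ). -/

import Mathlib

open MeasureTheory Real Filter Matrix

/-- Standard normal density on ℝ. -/
noncomputable def stdPdf (t : ℝ) : ℝ := (Real.sqrt (2 * Real.pi))⁻¹ * Real.exp (-t ^ 2 / 2)

/-- Standard normal cumulative distribution function Φ. -/
noncomputable def Phi (t : ℝ) : ℝ := ∫ s in Set.Iic t, stdPdf s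

/-- Standard `d`-dimensional normal density φ_d(x) = (2π)^{-d/2} exp(-‖x‖²/2). -/
noncomputable def phiD {d : ℕ} (x : Fin d → ℝ) : ℝ :=
  ((Real.sqrt (2 * Real.pi)) ^ d)⁻¹ * Real.exp (-(∑ i, x i ^ 2) / 2)

/-- The sequential bound l̃_k(x) = (l_k − Σ_{j<k} L_{kj} x_j)/L_{kk}
    (and likewise ũ_k(x) upon replacing `l` by `u`). -/
noncomputable def lTil {d : ℕ} (L : Matrix (Fin d) (Fin d) ℝ) (l : Fin d → ℝ)
    (x : Fin d → ℝ) (k : Fin d) : ℝ :=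
  (l k - ∑ j ∈ Finset.Iio k, L k j * x j) / L k k

/-- The polytope 𝒞 = {x : l ≤ Lx ≤ u}. -/
def Cset {d : ℕ} (L : Matrix (Fin d) (Fin d) ℝ) (l u : Fin d → ℝ) : Set (Fin d → ℝ) :=
  {x | ∀ i, l i ≤ L.mulVec x i ∧ L.mulVec x i ≤ u i}

/-- ψ(x;μ) = −xᵀμ + ‖μ‖²/2 + Σ_k log(Φ(ũ_k(x) − μ_k) − Φ(l̃_k(x) − μ_k)). -/
noncomputable def psi {d : ℕ} (L : Matrix (Fin d) (Fin d) ℝ) (l u : Fin d → ℝ)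
    (x μ : Fin d → ℝ) : ℝ :=
  -(∑ i, x i * μ i) + (∑ i, μ i ^ 2) / 2 +
    ∑ k, Real.log (Phi (lTil L u x k - μ k) - Phi (lTil L l x k - μ k))

/-- Sequential importance-sampling density g(x;μ). -/
noncomputable def gdens {d : ℕ} (L : Matrix (Fin d) (Fin d) ℝ) (l u : Fin d → ℝ)
    (x μ : Fin d → ℝ) : ℝ :=
  ∏ k, stdPdf (x k - μ k) *
      (if lTil L l x k ≤ x k ∧ x k ≤ lTil L u x k then (1 : ℝ) else 0) /
      (Phi (lTil L u x k - μ k) - Phi (lTil L l x k - μ k))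

/-- ℓ = ∫_𝒞 φ_d(x) dx. -/
noncomputable def lval {d : ℕ} (L : Matrix (Fin d) (Fin d) ℝ) (l u : Fin d → ℝ) : ℝ :=
  ∫ x in Cset L l u, phiD x

lemma stdPdf_eq_gaussianPDFReal : stdPdf = ProbabilityTheory.gaussianPDFReal 0 1 := by
  ext t
  simp [stdPdf, ProbabilityTheory.gaussianPDFReal]

lemma stdPdf_pos (t : ℝ) : 0 < stdPdf t := by
  unfold stdPdf
  positivity

@[fun_prop]
lemma continuous_stdPdf : Continuous stdPdf := by
  unfold stdPdf
  fun_prop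

lemma integrable_stdPdf : Integrable stdPdf := by
  rw [stdPdf_eq_gaussianPDFReal]
  exact ProbabilityTheory.integrable_gaussianPDFReal 0 1

lemma integral_stdPdf : ∫ t, stdPdf t = 1 := by
  rw [stdPdf_eq_gaussianPDFReal]
  exact ProbabilityTheory.integral_gaussianPDFReal_eq_one 0 one_ne_zero

lemma Phi_sub_Phi (a b : ℝ) : Phi b - Phi a = ∫ s in a..b, stdPdf s :=
  intervalIntegral.integral_Iic_sub_Iic integrable_stdPdf.integrableOn integrable_stdPdf.integrableOn

lemma Phi_strictMono : StrictMono Phi := fun a b hab => by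
  have h : 0 < ∫ s in a..b, stdPdf s :=
    intervalIntegral.intervalIntegral_pos_of_pos (continuous_stdPdf.intervalIntegrable a b)
      stdPdf_pos hab
  linarith [Phi_sub_Phi a b]

@[fun_prop]
lemma measurable_Phi : Measurable Phi := Phi_strictMono.monotone.measurable

lemma Phi_nonneg (t : ℝ) : 0 ≤ Phi t :=
  integral_nonneg fun s => (stdPdf_pos s).le

lemma Phi_le_one (t : ℝ) : Phi t ≤ 1 := by
  rw [← integral_stdPdf]
  exact setIntegral_le_integral integrable_stdPdf (ae_of_all _ fun s => (stdPdf_pos s).le)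

lemma lintegral_truncated_stdPdf_le_one (m : ℝ) {a b : ℝ} (hab : a < b) :
    ∫⁻ t, ENNReal.ofReal (stdPdf (t - m) * (if a ≤ t ∧ t ≤ b then (1 : ℝ) else 0) /
      (Phi (b - m) - Phi (a - m))) ≤ 1 := by
  have hZ : 0 < Phi (b - m) - Phi (a - m) := sub_pos.2 (Phi_strictMono (by linarith))
  have hind : ∀ t, ENNReal.ofReal (stdPdf (t - m) * (if a ≤ t ∧ t ≤ b then (1 : ℝ) else 0) /
      (Phi (b - m) - Phi (a - m))) = (Set.Icc a b).indicator
        (fun t => ENNReal.ofReal (stdPdf (t - m) / (Phi (b - m) - Phi (a - m)))) t := fun t => by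
    by_cases ht : a ≤ t ∧ t ≤ b
    · rw [Set.indicator_of_mem (Set.mem_Icc.2 ht), if_pos ht, mul_one]
    · rw [Set.indicator_of_notMem (mt Set.mem_Icc.1 ht), if_neg ht]
      simp
  simp_rw [hind]
  rw [lintegral_indicator measurableSet_Icc, ← ofReal_integral_eq_lintegral_ofReal,
    integral_div, integral_Icc_eq_integral_Ioc, ← intervalIntegral.integral_of_le hab.le,
    intervalIntegral.integral_comp_sub_right, ← Phi_sub_Phi, div_self hZ.ne', ENNReal.ofReal_one]
  · exact ((integrable_stdPdf.comp_sub_right m).div_const _).integrableOn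
  · exact ae_of_all _ fun t => div_nonneg (stdPdf_pos _).le hZ.le

/-- A product of sequential conditional subdensities has total mass at most one. -/
lemma lintegral_prod_sequential_le_one {d : ℕ} (F : Fin d → (Fin d → ℝ) → ENNReal)
    (hF : ∀ k, Measurable (F k))
    (hdep : ∀ k x y, (∀ j ≤ k, x j = y j) → F k x = F k y)
    (hint : ∀ k x, ∫⁻ t, F k (Function.update x k t) ≤ 1) :
    ∫⁻ x, ∏ k, F k x ≤ 1 := by
  induction d with
  | zero => simp [volume_pi]
  | succ n ih =>
    have hmp := (volume_preserving_piFinSuccAbove (fun _ : Fin (n + 1) => ℝ) (Fin.last n)).symm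
    have hsnoc : ∀ p : ℝ × (Fin n → ℝ),
        (MeasurableEquiv.piFinSuccAbove (fun _ : Fin (n + 1) => ℝ) (Fin.last n)).symm p =
          Fin.snoc (α := fun _ => ℝ) p.2 p.1 := fun p => by
      simp [MeasurableEquiv.piFinSuccAbove, Fin.insertNthEquiv, Fin.insertNth_last']
    have hmeas_snoc : Measurable fun p : ℝ × (Fin n → ℝ) =>
        (Fin.snoc (α := fun _ => ℝ) p.2 p.1 : Fin (n + 1) → ℝ) := by
      convert hmp.measurable using 2 with p
      exact (hsnoc p).symm
    have hprod : Measurable fun x => ∏ k, F k x := Finset.measurable_fun_prod _ fun k _ => hF k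
    rw [← hmp.lintegral_comp hprod]
    simp_rw [hsnoc]
    rw [Measure.volume_eq_prod, lintegral_prod_symm (fun p => ∏ k, F k (Fin.snoc (α := fun _ => ℝ) p.2 p.1))
      (hprod.comp hmeas_snoc).aemeasurable]
    have hinit : ∀ (k : Fin n) (t : ℝ) (y : Fin n → ℝ),
        F k.castSucc (Fin.snoc (α := fun _ => ℝ) y t) =
          F k.castSucc (Fin.snoc (α := fun _ => ℝ) y 0) := fun k t y => by
      refine hdep _ _ _ fun j hj => ?_
      obtain ⟨i, rfl⟩ : ∃ i : Fin n, i.castSucc = j :=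
        Fin.exists_castSucc_eq.2 (hj.trans_lt (Fin.castSucc_lt_last k)).ne
      simp
    refine le_trans (lintegral_mono fun y => ?_) (ih
      (fun k y => F k.castSucc (Fin.snoc (α := fun _ => ℝ) y 0)) (fun k => ?_)
      (fun k x y hxy => ?_) (fun k x => ?_))
    · simp_rw [Fin.prod_univ_castSucc, hinit]
      have hlast : Measurable fun t => F (Fin.last n) (Fin.snoc (α := fun _ => ℝ) y t) :=
        (hF _).comp (hmeas_snoc.comp (measurable_id.prodMk measurable_const))
      rw [lintegral_const_mul _ hlast]
      have h := hint (Fin.last n) (Fin.snoc (α := fun _ => ℝ) y 0)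
      simp_rw [Fin.update_snoc_last] at h
      exact mul_le_of_le_one_right' h
    · exact (hF _).comp (hmeas_snoc.comp (measurable_const.prodMk measurable_id))
    · refine hdep _ _ _ fun j hj => ?_
      obtain ⟨i, rfl⟩ : ∃ i : Fin n, i.castSucc = j :=
        Fin.exists_castSucc_eq.2 (hj.trans_lt (Fin.castSucc_lt_last k)).ne
      simpa using hxy i (by simpa using hj)
    · have h := hint k.castSucc (Fin.snoc (α := fun _ => ℝ) x 0)
      simpa only [← Fin.snoc_update] using h

section

variable {d : ℕ} (L : Matrix (Fin d) (Fin d) ℝ) (l u : Fin d → ℝ)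

@[fun_prop]
lemma measurable_lTil (k : Fin d) : Measurable fun x => lTil L l x k := by
  unfold lTil
  fun_prop

lemma lTil_congr {x y : Fin d → ℝ} {k : Fin d} (h : ∀ j < k, x j = y j) :
    lTil L l x k = lTil L l y k := by
  unfold lTil
  rw [Finset.sum_congr rfl fun j hj => by rw [h j (Finset.mem_Iio.1 hj)]]

variable {L l u}

lemma lTil_lt_lTil (hDiag : ∀ i, 0 < L i i) (hlu : ∀ k, l k < u k) (x : Fin d → ℝ) (k : Fin d) :
    lTil L l x k < lTil L u x k :=
  div_lt_div_of_pos_right (by linarith [hlu k]) (hDiag k)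

lemma Phi_lTil_sub_pos (hDiag : ∀ i, 0 < L i i) (hlu : ∀ k, l k < u k) (x μ : Fin d → ℝ)
    (k : Fin d) : 0 < Phi (lTil L u x k - μ k) - Phi (lTil L l x k - μ k) :=
  sub_pos.2 (Phi_strictMono (sub_lt_sub_right (lTil_lt_lTil hDiag hlu x k) _))

lemma mulVec_eq_of_lowerTriangular (hLow : ∀ i j : Fin d, i < j → L i j = 0) (x : Fin d → ℝ)
    (k : Fin d) : L.mulVec x k = ∑ j ∈ Finset.Iio k, L k j * x j + L k k * x k := by
  rw [add_comm, ← Finset.sum_insert (f := fun j => L k j * x j) (by simp), Finset.Iio_insert]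
  change ∑ j, L k j * x j = _
  refine (Finset.sum_subset (Finset.subset_univ _) fun j _ hj => ?_).symm
  rw [hLow k j (by simpa using hj), zero_mul]

lemma mem_Cset_iff (hLow : ∀ i j : Fin d, i < j → L i j = 0) (hDiag : ∀ i, 0 < L i i)
    (x : Fin d → ℝ) :
    x ∈ Cset L l u ↔ ∀ k, lTil L l x k ≤ x k ∧ x k ≤ lTil L u x k := by
  refine forall_congr' fun k => ?_
  rw [mulVec_eq_of_lowerTriangular hLow, lTil, lTil, div_le_iff₀ (hDiag k), le_div_iff₀ (hDiag k)]
  constructor <;> rintro ⟨h₁, h₂⟩ <;> constructor <;> linarith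

lemma measurableSet_Cset : MeasurableSet (Cset L l u) := by
  have : Cset L l u = L.mulVec ⁻¹' Set.Icc l u := by
    ext x
    simp [Cset, Pi.le_def, forall_and]
  rw [this]
  exact (isClosed_Icc.preimage (Continuous.matrix_mulVec continuous_const continuous_id)).measurableSet

lemma bddAbove_psi_image_Cset (hLow : ∀ i j : Fin d, i < j → L i j = 0)
    (hDiag : ∀ i, 0 < L i i) (hlu : ∀ k, l k < u k) (μ : Fin d → ℝ) :
    BddAbove ((fun x => psi L l u x μ) '' Cset L l u) := by
  have hdet : IsUnit L.det := by
    rw [Matrix.det_of_isLowerTriangular L fun i j h => hLow i j h]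
    exact (Finset.prod_pos fun i _ => hDiag i).ne'.isUnit
  have hK : IsCompact (L⁻¹.mulVec '' Set.Icc l u) :=
    isCompact_Icc.image (Continuous.matrix_mulVec continuous_const continuous_id)
  obtain ⟨B, hB⟩ := hK.bddAbove_image (f := fun x => -(∑ i, x i * μ i) + (∑ i, μ i ^ 2) / 2)
    (by fun_prop)
  refine ⟨B, ?_⟩
  rintro _ ⟨x, hx, rfl⟩
  have hxK : x ∈ L⁻¹.mulVec '' Set.Icc l u :=
    ⟨L.mulVec x, ⟨fun i => (hx i).1, fun i => (hx i).2⟩, by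
      rw [Matrix.mulVec_mulVec, Matrix.nonsing_inv_mul _ hdet, Matrix.one_mulVec]⟩
  have hlog : ∑ k, Real.log (Phi (lTil L u x k - μ k) - Phi (lTil L l x k - μ k)) ≤ 0 :=
    Finset.sum_nonpos fun k _ => Real.log_nonpos (Phi_lTil_sub_pos hDiag hlu x μ k).le (by
      linarith [Phi_le_one (lTil L u x k - μ k), Phi_nonneg (lTil L l x k - μ k)])
  have := hB (Set.mem_image_of_mem _ hxK)
  simp only [psi] at this ⊢
  linarith

lemma phiD_eq_exp_psi_mul_gdens (hLow : ∀ i j : Fin d, i < j → L i j = 0)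
    (hDiag : ∀ i, 0 < L i i) (hlu : ∀ k, l k < u k) (μ : Fin d → ℝ) {x : Fin d → ℝ}
    (hx : x ∈ Cset L l u) : phiD x = Real.exp (psi L l u x μ) * gdens L l u x μ := by
  rw [mem_Cset_iff hLow hDiag] at hx
  have hpsi : psi L l u x μ = ∑ k, (-(x k * μ k) + μ k ^ 2 / 2 +
      Real.log (Phi (lTil L u x k - μ k) - Phi (lTil L l x k - μ k))) := by
    simp [psi, Finset.sum_add_distrib, Finset.sum_div]
  have hphi : phiD x = ∏ k, stdPdf (x k) := by
    simp only [phiD, stdPdf, Finset.prod_mul_distrib, ← Real.exp_sum, Finset.prod_const,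
      Finset.card_univ, Fintype.card_fin, inv_pow, ← Finset.sum_div, Finset.sum_neg_distrib]
  rw [hpsi, hphi, Real.exp_sum, gdens, ← Finset.prod_mul_distrib]
  refine Finset.prod_congr rfl fun k _ => ?_
  have hZ := Phi_lTil_sub_pos hDiag hlu x μ k
  rw [if_pos (hx k), Real.exp_add, Real.exp_log hZ, mul_one, mul_assoc, mul_div_cancel₀ _ hZ.ne',
    stdPdf, stdPdf, mul_left_comm, ← Real.exp_add]
  ring_nf

lemma lintegral_gdens_le_one (hDiag : ∀ i, 0 < L i i) (hlu : ∀ k, l k < u k) (μ : Fin d → ℝ) :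
    ∫⁻ x, ENNReal.ofReal (gdens L l u x μ) ≤ 1 := by
  have hnonneg : ∀ x k, 0 ≤ stdPdf (x k - μ k) *
      (if lTil L l x k ≤ x k ∧ x k ≤ lTil L u x k then (1 : ℝ) else 0) /
      (Phi (lTil L u x k - μ k) - Phi (lTil L l x k - μ k)) := fun x k =>
    div_nonneg (mul_nonneg (stdPdf_pos _).le (by split_ifs <;> norm_num))
      (Phi_lTil_sub_pos hDiag hlu x μ k).le
  simp_rw [gdens, ENNReal.ofReal_prod_of_nonneg fun k _ => hnonneg _ k]
  refine lintegral_prod_sequential_le_one (fun k x => ENNReal.ofReal (stdPdf (x k - μ k) *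
      (if lTil L l x k ≤ x k ∧ x k ≤ lTil L u x k then (1 : ℝ) else 0) /
      (Phi (lTil L u x k - μ k) - Phi (lTil L l x k - μ k)))) (fun k => ?_)
    (fun k x y hxy => ?_) (fun k x => ?_)
  · have hset : MeasurableSet {x : Fin d → ℝ | lTil L l x k ≤ x k ∧ x k ≤ lTil L u x k} :=
      (measurableSet_le (measurable_lTil L l k) (measurable_pi_apply k)).inter
        (measurableSet_le (measurable_pi_apply k) (measurable_lTil L u k))
    have hite : Measurable fun x : Fin d → ℝ =>
        if lTil L l x k ≤ x k ∧ x k ≤ lTil L u x k then (1 : ℝ) else 0 :=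
      Measurable.ite hset measurable_const measurable_const
    have hpdf : Measurable fun x : Fin d → ℝ => stdPdf (x k - μ k) := by fun_prop
    exact ((hpdf.mul hite).div (by fun_prop)).ennreal_ofReal
  · simp only [lTil_congr L _ fun j hj => hxy j hj.le, hxy k le_rfl]
  · have hl (v : Fin d → ℝ) (t : ℝ) : lTil L v (Function.update x k t) k = lTil L v x k :=
      lTil_congr L v fun j hj => Function.update_of_ne hj.ne _ _
    simp_rw [hl, Function.update_self]
    exact lintegral_truncated_stdPdf_le_one (μ k) (lTil_lt_lTil hDiag hlu x k)

end

/-- deterministic upper bound — if 𝒞 is nonempty then for every μ,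
ℓ ≤ exp(sup_{x ∈ 𝒞} ψ(x;μ)); in particular ℓ ≤ exp(ψ(x*;μ*)) for a saddle point (x*,μ*). -/
theorem deterministic_upper_bound {d : ℕ} (hd : 1 ≤ d)
    (L : Matrix (Fin d) (Fin d) ℝ)
    (hLow : ∀ i j : Fin d, i < j → L i j = 0)
    (hDiag : ∀ i, 0 < L i i)
    (l u : Fin d → ℝ) (hlu : ∀ k, l k < u k)
    (hne : (Cset L l u).Nonempty) :
    ∀ μ : Fin d → ℝ,
      lval L l u ≤ Real.exp (sSup ((fun x => psi L l u x μ) '' Cset L l u)) := by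
  intro μ
  have hcont : Continuous (phiD : (Fin d → ℝ) → ℝ) := by
    unfold phiD
    fun_prop
  rw [lval, integral_eq_lintegral_of_nonneg_ae
    (ae_of_all _ fun x => by unfold phiD; positivity) hcont.aestronglyMeasurable]
  refine ENNReal.toReal_le_of_le_ofReal (Real.exp_pos _).le ?_
  set S := sSup ((fun x => psi L l u x μ) '' Cset L l u)
  calc ∫⁻ x in Cset L l u, ENNReal.ofReal (phiD x)
      ≤ ∫⁻ x in Cset L l u, ENNReal.ofReal (Real.exp S) * ENNReal.ofReal (gdens L l u x μ) := by
        refine setLIntegral_mono' measurableSet_Cset fun x hx => ?_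
        rw [phiD_eq_exp_psi_mul_gdens hLow hDiag hlu μ hx, ENNReal.ofReal_mul (Real.exp_pos _).le]
        gcongr
        exact le_csSup (bddAbove_psi_image_Cset hLow hDiag hlu μ) (Set.mem_image_of_mem _ hx)
    _ ≤ ∫⁻ x, ENNReal.ofReal (Real.exp S) * ENNReal.ofReal (gdens L l u x μ) :=
        setLIntegral_le_lintegral _ _
    _ = ENNReal.ofReal (Real.exp S) * ∫⁻ x, ENNReal.ofReal (gdens L l u x μ) :=
        lintegral_const_mul' _ _ ENNReal.ofReal_ne_top
    _ ≤ ENNReal.ofReal (Real.exp S) :=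
        mul_le_of_le_one_right' (lintegral_gdens_le_one hDiag hlu μ)
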